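/- arXiv:2510.06685 — 2 statements merged into one kernel-verified Lean document; each statement's English description precedes it below -/
import Mathlib

section
/- Fix β > 0. For each d ∈ ℕ let v, w_1, …, w_d be i.i.d. standard Gaussian vectors in ℝ^d. Then for every n ∈ ℕ, every δ ∈ (0, 1/2], and every ε > 0: d^n · P( | (1/d) Σ_{j=1}^d exp( β ⟨v, w_j⟩/√d ) − e^{β²/2} | > ε · d^{−1/2+δ} ) → 0 as d → ∞. -/
open MeasureTheory ProbabilityTheory Filter Matrix

/-- The binomial recursion satisfied by the moments of a sum of centered i.i.d. variables forces the
`m`-th moment of a sum of `d` terms to be `O(d ^ ⌊m / 2⌋)`. -/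
lemma exists_bound_of_moment_recursion {B : ℕ → ℝ} (hB : ∀ i, 0 ≤ B i) (m : ℕ) :
    ∃ C : ℝ, 0 ≤ C ∧ ∀ (a : ℕ → ℕ → ℝ) (y : ℕ → ℝ), (∀ i, |y i| ≤ B i) → y 0 = 1 → y 1 = 0 →
      (∀ k, a k 0 = 0 ^ k) →
      (∀ k d, a k (d + 1) = ∑ i ∈ Finset.range (k + 1), y i * a (k - i) d * (k.choose i : ℝ)) →
      ∀ d : ℕ, |a m d| ≤ C * (d : ℝ) ^ (m / 2) := by
  induction m using Nat.strong_induction_on with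
  | _ m ih =>
  match m, ih with
  | 0, _ =>
    refine ⟨1, zero_le_one, fun a y _ h0 _ ha hr d => ?_⟩
    have : a 0 d = 1 := by
      induction d with
      | zero => simp [ha]
      | succ d hd => simp [hr, hd, h0]
    simp [this]
  | 1, _ =>
    refine ⟨0, le_rfl, fun a y _ h0 h1 ha hr d => ?_⟩
    have : a 1 d = 0 := by
      induction d with
      | zero => simp [ha]
      | succ d hd => simp [hr, Finset.sum_range_succ, hd, h0, h1]
    simp [this]
  | k + 2, ih =>
    choose! C hC0 hC using ih
    have hD : 0 ≤ ∑ i ∈ Finset.range (k + 1), B (i + 2) * C (k - i) * ((k + 2).choose (i + 2) : ℝ) :=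
      Finset.sum_nonneg fun i _ =>
        mul_nonneg (mul_nonneg (hB _) (hC0 _ (by omega))) (Nat.cast_nonneg _)
    refine ⟨_, hD, fun a y hy h0 h1 ha hr d => ?_⟩
    set D := ∑ i ∈ Finset.range (k + 1), B (i + 2) * C (k - i) * ((k + 2).choose (i + 2) : ℝ)
    have hk : (k + 2) / 2 = k / 2 + 1 := by omega
    rw [hk]
    induction d with
    | zero => simp [ha]
    | succ d hd =>
      rw [hr, Finset.sum_range_succ', Finset.sum_range_succ']
      simp only [h0, h1, zero_add, zero_mul, add_zero, Nat.sub_zero, Nat.choose_zero_right,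
        Nat.cast_one, mul_one, one_mul]
      have hsum : |∑ i ∈ Finset.range (k + 1),
          y (i + 1 + 1) * a (k + 2 - (i + 1 + 1)) d * ((k + 2).choose (i + 1 + 1) : ℝ)|
          ≤ D * ((d : ℝ) + 1) ^ (k / 2) := by
        refine (Finset.abs_sum_le_sum_abs _ _).trans ?_
        rw [Finset.sum_mul]
        refine Finset.sum_le_sum fun i _ => ?_
        have e : k + 2 - (i + 1 + 1) = k - i := by omega
        rw [e, abs_mul, abs_mul, Nat.abs_cast]
        have h2 : |a (k - i) d| ≤ C (k - i) * ((d : ℝ) + 1) ^ (k / 2) := by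
          refine (hC (k - i) (by omega) a y hy h0 h1 ha hr d).trans
            (mul_le_mul_of_nonneg_left ?_ (hC0 _ (by omega)))
          calc (d : ℝ) ^ ((k - i) / 2) ≤ ((d : ℝ) + 1) ^ ((k - i) / 2) := by
                gcongr; linarith
            _ ≤ _ := pow_le_pow_right₀ (by linarith [(Nat.cast_nonneg d : (0 : ℝ) ≤ d)])
                (Nat.div_le_div_right (Nat.sub_le _ _))
        calc |y (i + 1 + 1)| * |a (k - i) d| * ((k + 2).choose (i + 1 + 1) : ℝ)
            ≤ B (i + 2) * (C (k - i) * ((d : ℝ) + 1) ^ (k / 2))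
                * ((k + 2).choose (i + 2) : ℝ) := by
              gcongr
              · exact hB _
              · exact hy _
          _ = _ := by ring
      have hp : (d : ℝ) ^ (k / 2 + 1) ≤ ((d : ℝ) + 1) ^ (k / 2) * d := by
        rw [pow_succ]
        gcongr
        linarith
      calc _ ≤ D * ((d : ℝ) + 1) ^ (k / 2) + D * (d : ℝ) ^ (k / 2 + 1) :=
            (abs_add_le _ _).trans (add_le_add hsum hd)
        _ ≤ D * ((d : ℝ) + 1) ^ (k / 2) + D * (((d : ℝ) + 1) ^ (k / 2) * d) := by gcongr
        _ = _ := by push_cast; ring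

section Moments

variable {Ω : Type*} [MeasurableSpace Ω] {μ : Measure Ω} [IsProbabilityMeasure μ] {g : Ω → ℝ}

lemma integrable_sum_pow (hg : ∀ i : ℕ, Integrable (fun x => g x ^ i) μ) (d m : ℕ) :
    Integrable (fun x : Fin d → Ω => (∑ j, g (x j)) ^ m) (Measure.pi fun _ => μ) := by
  induction d generalizing m with
  | zero => simp
  | succ d hd =>
    have hp := measurePreserving_piFinSuccAbove (fun _ : Fin (d + 1) => μ) 0
    have : Integrable (fun z : Ω × (Fin d → Ω) => (g z.1 + ∑ j, g (z.2 j)) ^ m)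
        (μ.prod (Measure.pi fun _ => μ)) := by
      simp_rw [add_pow]
      exact integrable_finsetSum _ fun i _ => ((hg i).mul_prod (hd (m - i))).mul_const _
    have h2 := (hp.integrable_comp_emb (MeasurableEquiv.measurableEmbedding _)).2 this
    refine h2.congr (ae_of_all _ fun x => ?_)
    simp [Fin.sum_univ_succ, MeasurableEquiv.piFinSuccAbove, Fin.tail]

lemma integral_sum_pow_succ (hg : ∀ i : ℕ, Integrable (fun x => g x ^ i) μ) (d m : ℕ) :
    ∫ x : Fin (d + 1) → Ω, (∑ j, g (x j)) ^ m ∂(Measure.pi fun _ => μ) =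
      ∑ i ∈ Finset.range (m + 1), (∫ x, g x ^ i ∂μ) *
        (∫ x : Fin d → Ω, (∑ j, g (x j)) ^ (m - i) ∂(Measure.pi fun _ => μ)) *
          (m.choose i : ℝ) := by
  have hp := measurePreserving_piFinSuccAbove (fun _ : Fin (d + 1) => μ) 0
  have h1 := hp.integral_comp (MeasurableEquiv.measurableEmbedding _)
    (fun z : Ω × (Fin d → Ω) => (g z.1 + ∑ j, g (z.2 j)) ^ m)
  have h2 : ∫ x : Fin (d + 1) → Ω, (∑ j, g (x j)) ^ m ∂(Measure.pi fun _ => μ) =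
      ∫ z : Ω × (Fin d → Ω), (g z.1 + ∑ j, g (z.2 j)) ^ m ∂(μ.prod (Measure.pi fun _ => μ)) := by
    rw [← h1]
    refine integral_congr_ae (ae_of_all _ fun x => ?_)
    simp [Fin.sum_univ_succ, MeasurableEquiv.piFinSuccAbove, Fin.tail]
  rw [h2]
  simp_rw [add_pow]
  rw [integral_finsetSum _ fun i _ =>
    ((hg i).mul_prod (integrable_sum_pow hg d (m - i))).mul_const _]
  refine Finset.sum_congr rfl fun i _ => ?_
  rw [integral_mul_const]
  congr 1
  exact integral_prod_mul (fun x => g x ^ i) (fun x : Fin d → Ω => (∑ j, g (x j)) ^ (m - i))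

end Moments

/-- Polynomial tail bound for sums of centered i.i.d. variables, uniform over all laws whose moments
are bounded by a given sequence. -/
lemma exists_tail_bound_sum (B : ℕ → ℝ) (k : ℕ) :
    ∃ C : ℝ, 0 ≤ C ∧ ∀ (Ω : Type) [MeasurableSpace Ω] (μ : Measure Ω) [IsProbabilityMeasure μ]
      (g : Ω → ℝ), (∀ i : ℕ, Integrable (fun x => g x ^ i) μ) → ∫ x, g x ∂μ = 0 →
      (∀ i, |∫ x, g x ^ i ∂μ| ≤ B i) → ∀ (d : ℕ) (s : ℝ), 0 < s →
      (Measure.pi fun _ : Fin d => μ).real {x | s ≤ |∑ j, g (x j)|} ≤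
        C * (d : ℝ) ^ k / s ^ (2 * k) := by
  obtain ⟨C, hC0, hC⟩ := exists_bound_of_moment_recursion (fun i => abs_nonneg (B i)) (2 * k)
  refine ⟨C, hC0, fun Ω _ μ _ g hg h1 hgB d s hs => ?_⟩
  have hb := hC (fun m d => ∫ x : Fin d → Ω, (∑ j, g (x j)) ^ m ∂(Measure.pi fun _ => μ))
    (fun i => ∫ x, g x ^ i ∂μ) (fun i => (hgB i).trans (le_abs_self _)) (by simp)
    (by simp only [pow_one, h1]) (fun m => by simp)
    (fun m d => integral_sum_pow_succ hg d m) d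
  rw [Nat.mul_div_cancel_left k two_pos] at hb
  have hs' : 0 < s ^ (2 * k) := pow_pos hs _
  have hsub : {x : Fin d → Ω | s ≤ |∑ j, g (x j)|} ⊆
      {x | s ^ (2 * k) ≤ (∑ j, g (x j)) ^ (2 * k)} := fun x hx => by
    simp only [Set.mem_ofPred_eq] at hx ⊢
    rw [← (even_two_mul k).pow_abs (∑ j, g (x j))]
    exact pow_le_pow_left₀ hs.le hx _
  have hmk : s ^ (2 * k) * (Measure.pi fun _ : Fin d => μ).real
      {x | s ^ (2 * k) ≤ (∑ j, g (x j)) ^ (2 * k)} ≤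
        ∫ x : Fin d → Ω, (∑ j, g (x j)) ^ (2 * k) ∂(Measure.pi fun _ => μ) :=
    mul_meas_ge_le_integral_of_nonneg
      (ae_of_all _ fun x => (even_two_mul k).pow_nonneg _) (integrable_sum_pow hg d (2 * k)) _
  rw [le_div_iff₀ hs']
  calc _ ≤ (Measure.pi fun _ : Fin d => μ).real
        {x | s ^ (2 * k) ≤ (∑ j, g (x j)) ^ (2 * k)} * s ^ (2 * k) :=
        mul_le_mul_of_nonneg_right (measureReal_mono hsub) hs'.le
    _ = s ^ (2 * k) * (Measure.pi fun _ : Fin d => μ).real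
        {x | s ^ (2 * k) ≤ (∑ j, g (x j)) ^ (2 * k)} := mul_comm _ _
    _ ≤ _ := hmk
    _ ≤ _ := (le_abs_self _).trans hb

lemma integrable_exp_dotProduct {d : ℕ} (c : Fin d → ℝ) :
    Integrable (fun w : Fin d → ℝ => Real.exp (c ⬝ᵥ w))
      (Measure.pi fun _ => gaussianReal 0 1) := by
  simp_rw [dotProduct, Real.exp_sum]
  exact Integrable.fintype_prod (f := fun i x => Real.exp (c i * x))
    fun i => integrable_exp_mul_gaussianReal (c i)

lemma integral_exp_dotProduct {d : ℕ} (c : Fin d → ℝ) :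
    ∫ w : Fin d → ℝ, Real.exp (c ⬝ᵥ w) ∂(Measure.pi fun _ => gaussianReal 0 1) =
      Real.exp (c ⬝ᵥ c / 2) := by
  simp_rw [dotProduct, Real.exp_sum]
  rw [integral_fintype_prod_eq_prod (fun i x => Real.exp (c i * x)), Finset.sum_div, Real.exp_sum]
  refine Finset.prod_congr rfl fun i _ => ?_
  have h := mgf_gaussianReal (p := gaussianReal 0 1) (X := id) (μ := 0) (v := 1)
    Measure.map_id (c i)
  simpa [mgf, sq] using h

lemma integrable_exp_dotProduct_sub_pow {d : ℕ} (c : Fin d → ℝ) (b : ℝ) (i : ℕ) :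
    Integrable (fun w : Fin d → ℝ => (Real.exp (c ⬝ᵥ w) - b) ^ i)
      (Measure.pi fun _ => gaussianReal 0 1) := by
  simp_rw [sub_eq_add_neg, add_pow, ← Real.exp_nat_mul]
  refine integrable_finsetSum _ fun j _ => Integrable.mul_const (Integrable.mul_const ?_ _) _
  simpa [smul_dotProduct] using integrable_exp_dotProduct ((j : ℝ) • c)

lemma abs_integral_exp_dotProduct_sub_pow_le {d : ℕ} {c : Fin d → ℝ} {R : ℝ} (hc : c ⬝ᵥ c ≤ R)
    (i : ℕ) :
    |∫ w : Fin d → ℝ, (Real.exp (c ⬝ᵥ w) - Real.exp (c ⬝ᵥ c / 2)) ^ i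
      ∂(Measure.pi fun _ => gaussianReal 0 1)| ≤
      2 ^ (i - 1) * (Real.exp ((i : ℝ) ^ 2 * R / 2) + Real.exp (i * (R / 2))) := by
  have hpow : ∀ w : Fin d → ℝ, Real.exp (c ⬝ᵥ w) ^ i = Real.exp (((i : ℝ) • c) ⬝ᵥ w) := fun w => by
    rw [← Real.exp_nat_mul, smul_dotProduct, smul_eq_mul]
  have hint : Integrable (fun w : Fin d → ℝ => Real.exp (((i : ℝ) • c) ⬝ᵥ w) +
      Real.exp (c ⬝ᵥ c / 2) ^ i) (Measure.pi fun _ => gaussianReal 0 1) :=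
    (integrable_exp_dotProduct _).add (integrable_const _)
  have hle : ∀ w : Fin d → ℝ, |(Real.exp (c ⬝ᵥ w) - Real.exp (c ⬝ᵥ c / 2)) ^ i| ≤
      2 ^ (i - 1) * (Real.exp (((i : ℝ) • c) ⬝ᵥ w) + Real.exp (c ⬝ᵥ c / 2) ^ i) := fun w => by
    rw [abs_pow, ← hpow]
    refine (pow_le_pow_left₀ (abs_nonneg _) ?_ i).trans
      (add_pow_le (Real.exp_pos _).le (Real.exp_pos _).le i)
    exact (abs_sub _ _).trans (by simp)
  calc _ ≤ ∫ w : Fin d → ℝ, |(Real.exp (c ⬝ᵥ w) - Real.exp (c ⬝ᵥ c / 2)) ^ i|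
        ∂(Measure.pi fun _ => gaussianReal 0 1) := abs_integral_le_integral_abs
    _ ≤ ∫ w : Fin d → ℝ, 2 ^ (i - 1) * (Real.exp (((i : ℝ) • c) ⬝ᵥ w) +
        Real.exp (c ⬝ᵥ c / 2) ^ i) ∂(Measure.pi fun _ => gaussianReal 0 1) :=
      integral_mono (integrable_exp_dotProduct_sub_pow c _ i).abs (hint.const_mul _) hle
    _ = 2 ^ (i - 1) * (Real.exp ((i : ℝ) ^ 2 * (c ⬝ᵥ c) / 2) + Real.exp (i * (c ⬝ᵥ c / 2))) := by
      rw [integral_const_mul, integral_add (integrable_exp_dotProduct _) (integrable_const _),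
        integral_exp_dotProduct, ← Real.exp_nat_mul]
      simp only [smul_dotProduct, dotProduct_smul, smul_eq_mul, integral_const, probReal_univ,
        one_mul]
      ring_nf
    _ ≤ _ := by gcongr

lemma exists_tail_bound_exp_dotProduct (R : ℝ) (k : ℕ) :
    ∃ C : ℝ, 0 ≤ C ∧ ∀ (d : ℕ) (c : Fin d → ℝ), c ⬝ᵥ c ≤ R → ∀ (N : ℕ) (s : ℝ), 0 < s →
      (Measure.pi fun _ : Fin N => Measure.pi fun _ : Fin d => gaussianReal 0 1).real
        {w | s ≤ |∑ j, (Real.exp (c ⬝ᵥ w j) - Real.exp (c ⬝ᵥ c / 2))|} ≤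
        C * (N : ℝ) ^ k / s ^ (2 * k) := by
  obtain ⟨C, hC0, hC⟩ := exists_tail_bound_sum
    (fun i => 2 ^ (i - 1) * (Real.exp ((i : ℝ) ^ 2 * R / 2) + Real.exp (i * (R / 2)))) k
  refine ⟨C, hC0, fun d c hc N s hs => hC _ _
    (fun w : Fin d → ℝ => Real.exp (c ⬝ᵥ w) - Real.exp (c ⬝ᵥ c / 2))
    (integrable_exp_dotProduct_sub_pow c _) ?_ (abs_integral_exp_dotProduct_sub_pow_le hc) N s hs⟩
  rw [integral_sub (integrable_exp_dotProduct c) (integrable_const _), integral_exp_dotProduct]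
  simp

lemma exists_tail_bound_sq (k : ℕ) :
    ∃ C : ℝ, 0 ≤ C ∧ ∀ (d : ℕ) (s : ℝ), 0 < s →
      (Measure.pi fun _ : Fin d => gaussianReal 0 1).real {v | s ≤ |∑ i, (v i ^ 2 - 1)|} ≤
        C * (d : ℝ) ^ k / s ^ (2 * k) := by
  obtain ⟨C, hC0, hC⟩ := exists_tail_bound_sum
    (fun i => |∫ x : ℝ, (x ^ 2 - 1) ^ i ∂(gaussianReal 0 1)|) k
  have hpow : ∀ m : ℕ, Integrable (fun x : ℝ => x ^ (2 * m)) (gaussianReal 0 1) := fun m => by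
    rcases Nat.eq_zero_or_pos m with rfl | hm
    · simp
    · have := (memLp_id_gaussianReal' (μ := 0) (v := 1) ((2 * m : ℕ) : ENNReal)
        (ENNReal.natCast_ne_top _)).integrable_norm_pow (by omega)
      simpa [(even_two_mul m).pow_abs] using this
  refine ⟨C, hC0, fun d s hs => hC ℝ (gaussianReal 0 1) (fun x => x ^ 2 - 1) (fun i => ?_) ?_
    (fun i => le_rfl) d s hs⟩
  · simp_rw [sub_eq_add_neg, add_pow, ← pow_mul]
    exact integrable_finsetSum _ fun j _ => ((hpow j).mul_const _).mul_const _
  · have hv : ∫ x : ℝ, x ^ 2 ∂(gaussianReal 0 1) = 1 := by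
      have h := variance_id_gaussianReal (μ := 0) (v := 1)
      rw [variance_eq_integral aemeasurable_id] at h
      simpa [integral_id_gaussianReal] using h
    rw [integral_sub (by simpa using hpow 1) (integrable_const _), hv]
    simp

lemma abs_exp_sub_exp_le {x y M : ℝ} (hx : x ≤ M) (hy : y ≤ M) :
    |Real.exp x - Real.exp y| ≤ Real.exp M * |x - y| := by
  wlog h : y ≤ x generalizing x y
  · rw [abs_sub_comm, abs_sub_comm x]
    exact this hy hx (le_of_not_ge h)
  rw [abs_of_nonneg (sub_nonneg.2 (Real.exp_le_exp.2 h)), abs_of_nonneg (sub_nonneg.2 h)]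
  have h1 : Real.exp y = Real.exp x * Real.exp (y - x) := by rw [← Real.exp_add]; ring_nf
  have h2 : Real.exp x - Real.exp y ≤ Real.exp x * (x - y) := by
    rw [h1]
    nlinarith [Real.add_one_le_exp (y - x), Real.exp_pos x]
  exact h2.trans (mul_le_mul_of_nonneg_right (Real.exp_le_exp.2 hx) (sub_nonneg.2 h))

lemma measureReal_prod_le_of_forall_slice {α γ : Type*} [MeasurableSpace α] [MeasurableSpace γ]
    {μ : Measure α} {ν : Measure γ} [IsProbabilityMeasure μ] [IsProbabilityMeasure ν]
    {G : Set (α × γ)} (hG : MeasurableSet G) {b : ℝ} (hb : 0 ≤ b)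
    (h : ∀ x, ν.real (Prod.mk x ⁻¹' G) ≤ b) : (μ.prod ν).real G ≤ b := by
  refine ENNReal.toReal_le_of_le_ofReal hb ?_
  rw [Measure.prod_apply hG]
  calc _ ≤ ∫⁻ _, ENNReal.ofReal b ∂μ := lintegral_mono fun x => by
        rw [← ofReal_measureReal]
        exact ENNReal.ofReal_le_ofReal (h x)
    _ = _ := by simp

lemma smul_sqrt_dotProduct_self (β : ℝ) {d : ℕ} (v : Fin d → ℝ) :
    ((β / √(d : ℝ)) • v) ⬝ᵥ ((β / √(d : ℝ)) • v) = β ^ 2 * ((v ⬝ᵥ v) / d) := by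
  rw [smul_dotProduct, dotProduct_smul, smul_eq_mul, smul_eq_mul, ← mul_assoc, ← sq, div_pow,
    Real.sq_sqrt (Nat.cast_nonneg d)]
  ring

lemma abs_dotProduct_div_sub_one_lt {d : ℕ} (hd : 0 < d) {v : Fin d → ℝ} {u : ℝ}
    (hv : |∑ i, (v i ^ 2 - 1)| < d * u) : |(v ⬝ᵥ v) / d - 1| < u := by
  have hd' : (0 : ℝ) < d := Nat.cast_pos.2 hd
  have : (v ⬝ᵥ v) / d - 1 = (∑ i, (v i ^ 2 - 1)) / d := by
    rw [Finset.sum_sub_distrib]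
    simp [dotProduct, sq]
    field_simp
  rw [this, abs_div, abs_of_pos hd', div_lt_iff₀ hd', mul_comm]
  exact hv

/-- If `|v|² / d` is close to one and the empirical mean deviates from `exp (β ^ 2 / 2)`, then the
empirical mean deviates from its conditional expectation given `v`. -/
lemma le_abs_sum_exp_sub {β ε κ t : ℝ} (hκ1 : κ * t ≤ 1)
    (hκε : Real.exp (β ^ 2) * (β ^ 2 / 2) * κ ≤ ε / 2) (ht : 0 ≤ t) {d : ℕ} (hd : 0 < d)
    {v : Fin d → ℝ} {w : Fin d → Fin d → ℝ} (hv : |∑ i, (v i ^ 2 - 1)| < d * (κ * t))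
    (h : ε * t < |(1 / (d : ℝ)) * ∑ j, Real.exp (β * (v ⬝ᵥ w j) / √(d : ℝ)) -
      Real.exp (β ^ 2 / 2)|) :
    d * (ε / 2 * t) ≤ |∑ j, (Real.exp (((β / √(d : ℝ)) • v) ⬝ᵥ w j) -
      Real.exp (((β / √(d : ℝ)) • v) ⬝ᵥ ((β / √(d : ℝ)) • v) / 2))| := by
  have hd' : (0 : ℝ) < d := Nat.cast_pos.2 hd
  have hS := abs_dotProduct_div_sub_one_lt hd hv
  rw [smul_sqrt_dotProduct_self]
  set S := (v ⬝ᵥ v) / d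
  have e1 : ∀ j, ((β / √(d : ℝ)) • v) ⬝ᵥ w j = β * (v ⬝ᵥ w j) / √(d : ℝ) := fun j => by
    rw [smul_dotProduct, smul_eq_mul]; ring
  simp_rw [e1]
  set T := ∑ j, Real.exp (β * (v ⬝ᵥ w j) / √(d : ℝ))
  have hb2 := sq_nonneg β
  have hx : β ^ 2 * S / 2 ≤ β ^ 2 := by nlinarith [(abs_lt.1 hS).2]
  have hL : |Real.exp (β ^ 2 * S / 2) - Real.exp (β ^ 2 / 2)| ≤ ε / 2 * t := by
    calc _ ≤ Real.exp (β ^ 2) * |β ^ 2 * S / 2 - β ^ 2 / 2| :=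
          abs_exp_sub_exp_le hx (by linarith)
      _ = Real.exp (β ^ 2) * (β ^ 2 / 2 * |S - 1|) := by
          rw [← abs_of_nonneg (show 0 ≤ β ^ 2 / 2 by positivity), ← abs_mul,
            abs_of_nonneg (show 0 ≤ β ^ 2 / 2 by positivity)]
          ring_nf
      _ ≤ Real.exp (β ^ 2) * (β ^ 2 / 2 * (κ * t)) := by gcongr
      _ = Real.exp (β ^ 2) * (β ^ 2 / 2) * κ * t := by ring
      _ ≤ _ := by gcongr
  have hT : |∑ j : Fin d, (Real.exp (β * (v ⬝ᵥ w j) / √(d : ℝ)) - Real.exp (β ^ 2 * S / 2))| =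
      d * |1 / (d : ℝ) * T - Real.exp (β ^ 2 * S / 2)| := by
    rw [← abs_of_pos hd', ← abs_mul, abs_of_pos hd', Finset.sum_sub_distrib]
    congr 1
    simp only [Finset.sum_const, Finset.card_univ, Fintype.card_fin, nsmul_eq_mul]
    field_simp
    rfl
  rw [hT]
  gcongr
  have := abs_sub_le (1 / (d : ℝ) * T) (Real.exp (β ^ 2 * S / 2)) (Real.exp (β ^ 2 / 2))
  linarith

lemma pow_div_rpow_eq {d : ℕ} (hd : 0 < d) (C κ δ : ℝ) (k : ℕ) :
    C * (d : ℝ) ^ k / (d * (κ * (d : ℝ) ^ (-(1 : ℝ) / 2 + δ))) ^ (2 * k) =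
      C / κ ^ (2 * k) * (d : ℝ) ^ (-(2 * k * δ)) := by
  have hd' : (0 : ℝ) < d := Nat.cast_pos.2 hd
  have h1 : ((d : ℝ) * (d : ℝ) ^ (-(1 : ℝ) / 2 + δ)) ^ (2 * k) =
      (d : ℝ) ^ k * (d : ℝ) ^ (2 * k * δ) := by
    nth_rewrite 1 [← Real.rpow_one (d : ℝ)]
    rw [← Real.rpow_add hd', ← Real.rpow_mul_natCast hd'.le, ← Real.rpow_natCast (d : ℝ) k,
      ← Real.rpow_add hd']
    congr 1
    push_cast
    ring
  rw [mul_left_comm, mul_pow, h1, Real.rpow_neg hd'.le]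
  have h2 : (d : ℝ) ^ (2 * k * δ) ≠ 0 := (Real.rpow_pos_of_pos hd' _).ne'
  have h3 : (d : ℝ) ^ k ≠ 0 := (pow_pos hd' _).ne'
  rw [div_eq_mul_inv, mul_inv, mul_inv]
  field_simp

/-- For every `k` the deviation probability is
`O(d ^ (-2 k δ))`. -/
lemma exists_deviation_bound (β : ℝ) {δ ε : ℝ} (hδ' : δ ≤ 1 / 2) (hε : 0 < ε) (k : ℕ) :
    ∃ K : ℝ, ∀ d : ℕ, 0 < d →
      (((Measure.pi fun _ : Fin d => gaussianReal 0 1).prod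
          (Measure.pi fun _ : Fin d => Measure.pi fun _ : Fin d => gaussianReal 0 1))
        {p : (Fin d → ℝ) × (Fin d → Fin d → ℝ) |
          ε * (d : ℝ) ^ (-(1 : ℝ) / 2 + δ) <
            |(1 / (d : ℝ)) * ∑ j, Real.exp (β * (p.1 ⬝ᵥ p.2 j) / Real.sqrt d) -
              Real.exp (β ^ 2 / 2)|}).toReal ≤ K * (d : ℝ) ^ (-(2 * k * δ)) := by
  obtain ⟨C₁, hC₁, h₁⟩ := exists_tail_bound_sq k
  obtain ⟨C₂, hC₂, h₂⟩ := exists_tail_bound_exp_dotProduct (2 * β ^ 2) k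
  set L := Real.exp (β ^ 2) * (β ^ 2 / 2)
  have hL : 0 ≤ L := by positivity
  set κ := min 1 (ε / 2 / (L + 1))
  have hκ : 0 < κ := lt_min one_pos (by positivity)
  have hκL : L * κ ≤ ε / 2 := by
    have : κ * (L + 1) ≤ ε / 2 := (le_div_iff₀ (by positivity)).1 (min_le_right _ _)
    nlinarith
  refine ⟨C₁ / κ ^ (2 * k) + C₂ / (ε / 2) ^ (2 * k), fun d hd => ?_⟩
  have hd' : (0 : ℝ) < d := Nat.cast_pos.2 hd
  set t := (d : ℝ) ^ (-(1 : ℝ) / 2 + δ)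
  have ht : 0 < t := Real.rpow_pos_of_pos hd' _
  have ht1 : t ≤ 1 := Real.rpow_le_one_of_one_le_of_nonpos (by exact_mod_cast hd) (by linarith)
  have hκ1 : κ * t ≤ 1 := mul_le_one₀ (min_le_left _ _) ht.le ht1
  set μ := Measure.pi fun _ : Fin d => gaussianReal 0 1
  set A : Set (Fin d → ℝ) := {v | d * (κ * t) ≤ |∑ i, (v i ^ 2 - 1)|}
  set G : Set ((Fin d → ℝ) × (Fin d → Fin d → ℝ)) :=
    {p | |∑ i, (p.1 i ^ 2 - 1)| < d * (κ * t) ∧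
      d * (ε / 2 * t) ≤ |∑ j, (Real.exp (((β / √(d : ℝ)) • p.1) ⬝ᵥ p.2 j) -
        Real.exp (((β / √(d : ℝ)) • p.1) ⬝ᵥ ((β / √(d : ℝ)) • p.1) / 2))|}
  have hG : MeasurableSet G := by
    have h1 : Measurable fun p : (Fin d → ℝ) × (Fin d → Fin d → ℝ) =>
        |∑ i, (p.1 i ^ 2 - 1)| := by fun_prop
    have h2 : Measurable fun p : (Fin d → ℝ) × (Fin d → Fin d → ℝ) =>
        |∑ j, (Real.exp (((β / √(d : ℝ)) • p.1) ⬝ᵥ p.2 j) -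
          Real.exp (((β / √(d : ℝ)) • p.1) ⬝ᵥ ((β / √(d : ℝ)) • p.1) / 2))| := by
      simp only [dotProduct, Pi.smul_apply, smul_eq_mul]
      fun_prop
    exact (measurableSet_lt h1 measurable_const).inter (measurableSet_le measurable_const h2)
  have hA : (μ.prod (Measure.pi fun _ : Fin d => μ)).real (A ×ˢ Set.univ) ≤
      C₁ / κ ^ (2 * k) * (d : ℝ) ^ (-(2 * k * δ)) := by
    rw [measureReal_prod_prod, probReal_univ, mul_one, ← pow_div_rpow_eq hd]
    exact h₁ d _ (by positivity)
  have hGle : (μ.prod (Measure.pi fun _ : Fin d => μ)).real G ≤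
      C₂ / (ε / 2) ^ (2 * k) * (d : ℝ) ^ (-(2 * k * δ)) := by
    refine measureReal_prod_le_of_forall_slice hG (by positivity) fun v => ?_
    by_cases hv : |∑ i, (v i ^ 2 - 1)| < d * (κ * t)
    · have hc : ((β / √(d : ℝ)) • v) ⬝ᵥ ((β / √(d : ℝ)) • v) ≤ 2 * β ^ 2 := by
        rw [smul_sqrt_dotProduct_self]
        nlinarith [(abs_lt.1 (abs_dotProduct_div_sub_one_lt hd hv)).2, sq_nonneg β]
      rw [← pow_div_rpow_eq hd]
      exact (measureReal_mono fun w hw => hw.2).trans (h₂ d _ hc d _ (by positivity))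
    · have : Prod.mk v ⁻¹' G = ∅ := Set.eq_empty_of_forall_notMem fun w hw => hv hw.1
      rw [this, measureReal_empty]
      positivity
  rw [add_mul]
  refine (measureReal_mono (s₂ := A ×ˢ Set.univ ∪ G) fun p hp => ?_).trans
    ((measureReal_union_le _ _).trans (add_le_add hA hGle))
  by_cases hv : |∑ i, (p.1 i ^ 2 - 1)| < d * (κ * t)
  · exact Or.inr ⟨hv, le_abs_sum_exp_sub hκ1 hκL ht.le hd hv hp⟩
  · exact Or.inl ⟨not_lt.1 hv, trivial⟩

/-- Fix `β > 0`. For each `d`, let `v, w_1, …, w_d` be i.i.d. standard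
Gaussian vectors in `ℝ^d`. Then for every `n ∈ ℕ`, `δ ∈ (0,1/2]`, and `ε > 0`:
`d^n · P(|(1/d) Σ_j exp(β⟨v,w_j⟩/√d) − e^{β²/2}| > ε d^{−1/2+δ}) → 0` as `d → ∞`. -/
theorem stmt11 (β : ℝ) (hβ : 0 < β) (n : ℕ) (δ ε : ℝ) (hδ : 0 < δ) (hδ' : δ ≤ 1 / 2)
    (hε : 0 < ε) :
    Tendsto (fun d : ℕ => (d : ℝ) ^ n *
      (((Measure.pi fun _ : Fin d => gaussianReal 0 1).prod
          (Measure.pi fun _ : Fin d => Measure.pi fun _ : Fin d => gaussianReal 0 1))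
        {p : (Fin d → ℝ) × (Fin d → Fin d → ℝ) |
          ε * (d : ℝ) ^ (-(1 : ℝ) / 2 + δ) <
            |(1 / (d : ℝ)) * ∑ j, Real.exp (β * (p.1 ⬝ᵥ p.2 j) / Real.sqrt d) -
              Real.exp (β ^ 2 / 2)|}).toReal)
      atTop (nhds 0) := by
  obtain ⟨k, hk⟩ := exists_nat_gt ((n : ℝ) / (2 * δ))
  rw [div_lt_iff₀ (by positivity)] at hk
  obtain ⟨K, hK⟩ := exists_deviation_bound β hδ' hε k
  have hlim : Tendsto (fun d : ℕ => K * (d : ℝ) ^ (-(2 * k * δ - n))) atTop (nhds 0) := by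
    simpa using ((tendsto_rpow_neg_atTop (y := 2 * k * δ - n) (by linarith)).comp
      tendsto_natCast_atTop_atTop).const_mul K
  refine squeeze_zero' (Eventually.of_forall fun d => by positivity) ?_ hlim
  filter_upwards [eventually_gt_atTop 0] with d hd
  have hd' : (0 : ℝ) < d := Nat.cast_pos.2 hd
  calc _ ≤ (d : ℝ) ^ n * (K * (d : ℝ) ^ (-(2 * k * δ))) := by
        gcongr
        exact hK d hd
    _ = _ := by
        rw [mul_left_comm, ← Real.rpow_natCast (d : ℝ) n, ← Real.rpow_add hd']
        ring_nf
end

section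
/- Fix β > 0 and δ ∈ (0, 1/2]. Then, almost surely, lim_{d→∞} max_{1≤i≤d} d^{1/2−δ} · | (1/d) Σ_{j=1}^d exp( β (S_d)_{ij} ) − e^{β²/2} | = 0. -/
open MeasureTheory ProbabilityTheory Filter Matrix Real

/-- The score matrix `S_d = W^Q_d (W^K_d)ᵀ / √d`. -/
noncomputable def scoreS {Ω : Type*} (WQ WK : (d : ℕ) → Ω → Fin d → Fin d → ℝ)
    (d : ℕ) (ω : Ω) : Matrix (Fin d) (Fin d) ℝ :=
  (Real.sqrt d)⁻¹ • (Matrix.of (WQ d ω) * (Matrix.of (WK d ω))ᵀ)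

lemma abs_pow_le_one_add_pow (a : ℝ) {k p : ℕ} (h : k ≤ 2 * p) :
    |a| ^ k ≤ 1 + a ^ (2 * p) := by
  have h0 : a ^ (2 * p) = |a| ^ (2 * p) := by rw [pow_mul, pow_mul, sq_abs]
  rw [h0]
  have hp : 0 ≤ |a| ^ (2 * p) := by positivity
  rcases le_total |a| 1 with h1 | h1
  · linarith [pow_le_one₀ (n := k) (abs_nonneg a) h1]
  · linarith [pow_le_pow_right₀ h1 h]

/-- An even power of a sum, expanded to first order in the second summand. -/
lemma add_pow_even_le (s x : ℝ) (m : ℕ) :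
    (s + x) ^ (2 * (m + 1)) ≤ s ^ (2 * (m + 1)) + (2 * (m + 1)) * (s ^ (2 * m + 1) * x) +
      4 ^ (m + 1) * ((1 + s ^ (2 * m)) * (1 + x ^ (2 * (m + 1)))) := by
  have e : 2 * (m + 1) = 2 * m + 1 + 1 := by ring
  rw [add_comm s x, add_pow, e, Finset.sum_range_succ', Finset.sum_range_succ']
  have hb : ∑ k ∈ Finset.range (2 * m + 1),
      x ^ (k + 1 + 1) * s ^ (2 * m + 1 + 1 - (k + 1 + 1)) * ((2 * m + 1 + 1).choose (k + 1 + 1) : ℝ)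
      ≤ 4 ^ (m + 1) * ((1 + s ^ (2 * m)) * (1 + x ^ (2 * (m + 1)))) := by
    have hs : 0 ≤ s ^ (2 * m) := by rw [pow_mul]; positivity
    have hx : 0 ≤ x ^ (2 * (m + 1)) := by rw [pow_mul]; positivity
    calc _ ≤ ∑ k ∈ Finset.range (2 * m + 1), ((1 + s ^ (2 * m)) * (1 + x ^ (2 * (m + 1)))) *
            ((2 * m + 1 + 1).choose (k + 1 + 1) : ℝ) := by
          refine Finset.sum_le_sum fun k hk => ?_
          rw [Finset.mem_range] at hk
          refine mul_le_mul_of_nonneg_right ?_ (by positivity)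
          refine (le_abs_self _).trans ?_
          rw [abs_mul, abs_pow, abs_pow, mul_comm]
          exact mul_le_mul (abs_pow_le_one_add_pow s (by omega))
            (abs_pow_le_one_add_pow x (by omega)) (by positivity) (by positivity)
      _ = ((1 + s ^ (2 * m)) * (1 + x ^ (2 * (m + 1)))) *
            ∑ k ∈ Finset.range (2 * m + 1), ((2 * m + 1 + 1).choose (k + 1 + 1) : ℝ) := by
          rw [Finset.mul_sum]
      _ ≤ ((1 + s ^ (2 * m)) * (1 + x ^ (2 * (m + 1)))) * 4 ^ (m + 1) := by
          refine mul_le_mul_of_nonneg_left ?_ (by positivity)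
          have h1 : ∑ k ∈ Finset.range (2 * m + 1 + 1 + 1), ((2 * m + 1 + 1).choose k : ℝ)
              = 4 ^ (m + 1) := by
            have := Nat.sum_range_choose (2 * m + 1 + 1)
            have h4 : (4 : ℝ) ^ (m + 1) = 2 ^ (2 * m + 1 + 1) := by
              rw [← e, pow_mul]; norm_num
            rw [h4]
            exact_mod_cast this
          rw [Finset.sum_range_succ', Finset.sum_range_succ'] at h1
          rw [← h1]
          have : (0 : ℝ) ≤ ((2 * m + 1 + 1).choose (0 + 1) : ℝ) := by positivity
          have : (0 : ℝ) ≤ ((2 * m + 1 + 1).choose 0 : ℝ) := by positivity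
          linarith
      _ = _ := mul_comm _ _
  rw [e] at hb
  simp only [zero_add, pow_one, pow_zero, one_mul, Nat.choose_one_right, Nat.choose_zero_right,
    Nat.cast_one, mul_one, Nat.sub_zero, Nat.add_sub_cancel]
  push_cast
  push_cast at hb
  linarith

lemma memLp_of_integrable_even_pow {Ω : Type*} {mΩ : MeasurableSpace Ω} {μ : Measure Ω}
    [IsProbabilityMeasure μ] {f : Ω → ℝ} (hf : AEStronglyMeasurable f μ)
    (h : ∀ p : ℕ, Integrable (fun x => f x ^ (2 * p)) μ) (p : ℕ) : MemLp f p μ := by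
  have : MemLp f ((2 * (p + 1) : ℕ) : ENNReal) μ := by
    rw [← integrable_norm_rpow_iff hf (by simp) (ENNReal.natCast_ne_top _)]
    refine (h (p + 1)).congr (Eventually.of_forall fun x => ?_)
    simp only [ENNReal.toReal_natCast, Real.rpow_natCast, Real.norm_eq_abs]
    rw [pow_mul, pow_mul, sq_abs]
  exact this.mono_exponent (by exact_mod_cast (by omega : p ≤ 2 * (p + 1)))

lemma integrable_pow_of_memLp {Ω : Type*} {mΩ : MeasurableSpace Ω} {μ : Measure Ω}
    [IsProbabilityMeasure μ] {f : Ω → ℝ} (hf : ∀ p : ℕ, MemLp f p μ) (p : ℕ) :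
    Integrable (fun x => f x ^ p) μ := by
  rcases eq_or_ne p 0 with rfl | hp
  · simp
  · refine ((hf p).integrable_norm_pow hp).mono' ((hf p).aestronglyMeasurable.pow p) ?_
    exact Eventually.of_forall fun x => (norm_pow _ _).le

/-- Constants in the moment bound for sums of independent centered variables whose even moments
are bounded by `B`. -/
noncomputable def momentConst (B : ℕ → ℝ) : ℕ → ℝ
  | 0 => 1
  | m + 1 => 4 ^ (m + 1) * ((1 + momentConst B m) * (1 + B (m + 1)))

lemma momentConst_nonneg {B : ℕ → ℝ} (hB : ∀ m, 0 ≤ B m) (m : ℕ) : 0 ≤ momentConst B m := by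
  induction m with
  | zero => simp [momentConst]
  | succ m ih => have := hB (m + 1); simp only [momentConst]; positivity

/-- Even moments of a sum of independent centered variables are of the order of the corresponding
power of the number of summands. -/
lemma integral_sum_pow_le {Ω ι : Type*} {mΩ : MeasurableSpace Ω} {μ : Measure Ω}
    [IsProbabilityMeasure μ] {X : ι → Ω → ℝ} {B : ℕ → ℝ} (hB : ∀ m, 0 ≤ B m)
    (hind : iIndepFun X μ) (hmeas : ∀ i, Measurable (X i)) (hLp : ∀ i (p : ℕ), MemLp (X i) p μ)
    (hzero : ∀ i, ∫ ω, X i ω ∂μ = 0) (hmom : ∀ i m, ∫ ω, X i ω ^ (2 * m) ∂μ ≤ B m)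
    (m : ℕ) (s : Finset ι) :
    ∫ ω, (∑ i ∈ s, X i ω) ^ (2 * m) ∂μ ≤ momentConst B m * (s.card : ℝ) ^ m := by
  classical
  induction m generalizing s with
  | zero => simp [momentConst]
  | succ m ihm =>
    induction s using Finset.induction_on with
    | empty => simp
    | insert a s ha ihs =>
      have hC := momentConst_nonneg hB
      have hSLp : ∀ p : ℕ, MemLp (fun ω => ∑ i ∈ s, X i ω) p μ :=
        fun p => memLp_finsetSum s fun i _ => hLp i p
      have hS := integrable_pow_of_memLp hSLp
      have hX := integrable_pow_of_memLp (hLp a)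
      have hind' : IndepFun (fun ω => ∑ i ∈ s, X i ω) (X a) μ := by
        have := hind.indepFun_finsetSum_of_notMem hmeas ha
        convert this using 1
        ext ω; simp
      have h1 : IndepFun (fun ω => (∑ i ∈ s, X i ω) ^ (2 * m + 1)) (X a) μ :=
        hind'.comp (φ := fun x : ℝ => x ^ (2 * m + 1)) (ψ := id) (by fun_prop) measurable_id
      have h2 : IndepFun (fun ω => 1 + (∑ i ∈ s, X i ω) ^ (2 * m))
          (fun ω => 1 + X a ω ^ (2 * (m + 1))) μ :=
        hind'.comp (φ := fun x : ℝ => 1 + x ^ (2 * m)) (ψ := fun x : ℝ => 1 + x ^ (2 * (m + 1)))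
          (by fun_prop) (by fun_prop)
      have hXi : Integrable (X a) μ := by simpa using hX 1
      have i1 : Integrable (fun ω => (∑ i ∈ s, X i ω) ^ (2 * m + 1) * X a ω) μ :=
        h1.integrable_mul (hS _) hXi
      have j2 : Integrable (fun ω => 1 + (∑ i ∈ s, X i ω) ^ (2 * m)) μ :=
        (integrable_const 1).add (hS _)
      have k2 : Integrable (fun ω => 1 + X a ω ^ (2 * (m + 1))) μ :=
        (integrable_const 1).add (hX _)
      have i2 : Integrable (fun ω => (1 + (∑ i ∈ s, X i ω) ^ (2 * m)) *
          (1 + X a ω ^ (2 * (m + 1)))) μ := h2.integrable_mul j2 k2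
      have e1 : ∫ ω, (∑ i ∈ s, X i ω) ^ (2 * m + 1) * X a ω ∂μ = 0 := by
        rw [h1.integral_fun_mul_eq_mul_integral (hS _).1 hXi.1, hzero a, mul_zero]
      have e2 : ∫ ω, (1 + (∑ i ∈ s, X i ω) ^ (2 * m)) * (1 + X a ω ^ (2 * (m + 1))) ∂μ
          ≤ (1 + momentConst B m * (s.card : ℝ) ^ m) * (1 + B (m + 1)) := by
        rw [h2.integral_fun_mul_eq_mul_integral j2.1 k2.1,
          integral_add (integrable_const 1) (hS _), integral_add (integrable_const 1) (hX _)]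
        have p1 : 0 ≤ ∫ ω, X a ω ^ (2 * (m + 1)) ∂μ :=
          integral_nonneg fun ω => by simp only [pow_mul, Pi.zero_apply]; positivity
        have p2 := hC m
        simp only [integral_const, probReal_univ, smul_eq_mul, mul_one]
        gcongr
        · exact ihm s
        · exact hmom a _
      have key : ∫ ω, (∑ i ∈ insert a s, X i ω) ^ (2 * (m + 1)) ∂μ ≤
          ∫ ω, ((∑ i ∈ s, X i ω) ^ (2 * (m + 1)) +
            (2 * (m + 1)) * ((∑ i ∈ s, X i ω) ^ (2 * m + 1) * X a ω) +
            4 ^ (m + 1) * ((1 + (∑ i ∈ s, X i ω) ^ (2 * m)) * (1 + X a ω ^ (2 * (m + 1))))) ∂μ := by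
        refine integral_mono_of_nonneg (Eventually.of_forall fun ω => ?_)
          (((hS _).add (i1.const_mul _)).add (i2.const_mul _)) (Eventually.of_forall fun ω => ?_)
        · simp only [pow_mul, Pi.zero_apply]; positivity
        · simp only [Finset.sum_insert ha]
          rw [add_comm (X a ω)]
          exact add_pow_even_le _ _ m
      rw [integral_add (by exact (hS _).add (i1.const_mul _)) (i2.const_mul _),
        integral_add (hS _) (i1.const_mul _), integral_const_mul, integral_const_mul, e1] at key
      refine key.trans ?_
      rw [Finset.card_insert_of_notMem ha]
      push_cast
      set n : ℝ := (s.card : ℝ)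
      have hn : 0 ≤ n := by positivity
      have hBm := hB (m + 1)
      have hCm := hC m
      have b1 : 1 + momentConst B m * n ^ m ≤ (1 + momentConst B m) * (n + 1) ^ m := by
        have : 1 ≤ (n + 1) ^ m := one_le_pow₀ (by linarith)
        have : n ^ m ≤ (n + 1) ^ m := by gcongr; linarith
        nlinarith
      have b2 : n ^ (m + 1) ≤ n * (n + 1) ^ m := by
        rw [pow_succ, mul_comm]; gcongr; linarith
      calc _ ≤ momentConst B (m + 1) * n ^ (m + 1) + 2 * (m + 1) * 0 +
            4 ^ (m + 1) * ((1 + momentConst B m * n ^ m) * (1 + B (m + 1))) := by gcongr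
        _ ≤ momentConst B (m + 1) * (n * (n + 1) ^ m) + 2 * (m + 1) * 0 +
            4 ^ (m + 1) * (((1 + momentConst B m) * (n + 1) ^ m) * (1 + B (m + 1))) := by
          have := hC (m + 1)
          gcongr
        _ = momentConst B (m + 1) * (n + 1) ^ (m + 1) := by
          simp only [momentConst]; ring

/-- Polynomial concentration of empirical means at scale slightly above `n ^ (-1/2)`. -/
lemma measureReal_mean_ge_le {E : Type*} [MeasurableSpace E] {μ : Measure E}
    [IsProbabilityMeasure μ] {f : E → ℝ} {B : ℕ → ℝ} (hB : ∀ m, 0 ≤ B m)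
    (hmeas : Measurable f) (hLp : ∀ p : ℕ, MemLp f p μ)
    (hzero : ∫ x, f x ∂μ = 0) (hmom : ∀ m, ∫ x, f x ^ (2 * m) ∂μ ≤ B m)
    {c γ : ℝ} (hc : 0 < c) {m : ℕ} (hm : 3 ≤ 2 * m * γ) {n : ℕ} (hn : 0 < n) :
    (Measure.pi fun _ : Fin n => μ).real
      {x | c * (n : ℝ) ^ (-(1 / 2 - γ)) ≤ |(1 / (n : ℝ)) * ∑ j, f (x j)|} ≤
      momentConst B m / c ^ (2 * m) * ((n : ℝ) ^ 3)⁻¹ := by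
  have hn1 : (1 : ℝ) ≤ n := by exact_mod_cast hn
  have hn0 : (0 : ℝ) < n := by linarith
  have hmp := fun j : Fin n => measurePreserving_eval (fun _ : Fin n => μ) j
  have hLp' : ∀ (j : Fin n) (p : ℕ), MemLp (fun x : Fin n → E => f (x j)) p
      (Measure.pi fun _ : Fin n => μ) := fun j p => (hLp p).comp_measurePreserving (hmp j)
  have hmain := integral_sum_pow_le (X := fun (j : Fin n) (x : Fin n → E) => f (x j)) hB
    (iIndepFun_pi (μ := fun _ : Fin n => μ) (X := fun _ => f) fun _ => hmeas.aemeasurable)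
    (fun j => hmeas.comp (measurable_pi_apply j)) hLp'
    (fun j => by
      rw [integral_comp_eval (μ := fun _ : Fin n => μ) (f := f) hmeas.aestronglyMeasurable, hzero])
    (fun j m => by
      rw [integral_comp_eval (μ := fun _ : Fin n => μ) (f := fun x => f x ^ (2 * m))
        (hmeas.pow_const _).aestronglyMeasurable]
      exact hmom m) m Finset.univ
  rw [Finset.card_univ, Fintype.card_fin] at hmain
  set t : ℝ := c * (n : ℝ) ^ (-(1 / 2 - γ)) with ht
  have ht0 : 0 < t := by positivity
  have hmk := mul_meas_ge_le_integral_of_nonneg (μ := Measure.pi fun _ : Fin n => μ)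
    (f := fun x => (∑ j, f (x j)) ^ (2 * m))
    (Eventually.of_forall fun ω => by simp only [pow_mul, Pi.zero_apply]; positivity)
    (integrable_pow_of_memLp (fun p => memLp_finsetSum _ fun j _ => hLp' j p) _) ((n * t) ^ (2 * m))
  have hsub : {x : Fin n → E | t ≤ |(1 / (n : ℝ)) * ∑ j, f (x j)|} ⊆
      {x | (n * t) ^ (2 * m) ≤ (∑ j, f (x j)) ^ (2 * m)} := by
    intro x hx
    simp only [Set.mem_ofPred_eq] at hx ⊢
    rw [abs_mul, abs_of_nonneg (by positivity : 0 ≤ 1 / (n : ℝ)), one_div, inv_mul_eq_div,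
      le_div_iff₀ hn0] at hx
    rw [pow_mul (∑ j, f (x j)) 2 m, ← sq_abs (∑ j, f (x j)), ← pow_mul]
    exact pow_le_pow_left₀ (by positivity) (by linarith) _
  have h1 := (measureReal_mono (μ := Measure.pi fun _ : Fin n => μ) hsub)
  refine h1.trans ?_
  have hpow : c ^ (2 * m) * ((n : ℝ) ^ m * (n : ℝ) ^ 3) ≤ (n * t) ^ (2 * m) := by
    have e1 : (n : ℝ) * t = c * (n : ℝ) ^ (1 / 2 + γ) := by
      have : (n : ℝ) ^ (1 / 2 + γ) = n * (n : ℝ) ^ (-(1 / 2 - γ)) := by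
        rw [show (1 / 2 + γ) = 1 + (-(1 / 2 - γ)) by ring, Real.rpow_add hn0, Real.rpow_one]
      rw [this, ht]; ring
    rw [e1, mul_pow]
    gcongr
    rw [← Real.rpow_natCast, ← Real.rpow_natCast, ← Real.rpow_natCast, ← Real.rpow_add hn0,
      ← Real.rpow_mul hn0.le]
    apply Real.rpow_le_rpow_of_exponent_le hn1
    push_cast
    nlinarith
  set p := (Measure.pi fun _ : Fin n => μ).real {x | (n * t) ^ (2 * m) ≤ (∑ j, f (x j)) ^ (2 * m)}
  have hp : 0 ≤ p := measureReal_nonneg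
  have hfin : c ^ (2 * m) * ((n : ℝ) ^ m * (n : ℝ) ^ 3) * p ≤ momentConst B m * (n : ℝ) ^ m :=
    (mul_le_mul_of_nonneg_right hpow hp).trans (hmk.trans hmain)
  have hnm : 0 < (n : ℝ) ^ m := by positivity
  have hfin' : c ^ (2 * m) * (n : ℝ) ^ 3 * p ≤ momentConst B m := by
    refine le_of_mul_le_mul_right ?_ hnm
    linarith
  rw [← div_eq_mul_inv, div_div, le_div_iff₀ (by positivity)]
  linarith

lemma integrable_exp_linear_gaussian {n : ℕ} (v : Fin n → ℝ) :
    Integrable (fun x : Fin n → ℝ => Real.exp (∑ k, v k * x k))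
      (Measure.pi fun _ : Fin n => gaussianReal 0 1) := by
  simp only [Real.exp_sum]
  exact Integrable.fintype_prod (f := fun k y => Real.exp (v k * y))
    fun k => integrable_exp_mul_gaussianReal (v k)

lemma integral_exp_linear_gaussian {n : ℕ} (v : Fin n → ℝ) :
    ∫ x : Fin n → ℝ, Real.exp (∑ k, v k * x k) ∂(Measure.pi fun _ : Fin n => gaussianReal 0 1) =
      Real.exp ((∑ k, v k ^ 2) / 2) := by
  simp only [Real.exp_sum, Finset.sum_div]
  rw [integral_fintype_prod_eq_prod (fun k y => Real.exp (v k * y))]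
  refine Finset.prod_congr rfl fun k _ => ?_
  have := mgf_gaussianReal (p := gaussianReal 0 1) (X := id) Measure.map_id (v k)
  simpa [mgf] using this

lemma sub_pow_even_le {a b : ℝ} (ha : 0 ≤ a) (hb : 0 ≤ b) (m : ℕ) :
    (a - b) ^ (2 * m) ≤ a ^ (2 * m) + b ^ (2 * m) := by
  have h0 : (a - b) ^ (2 * m) = |a - b| ^ (2 * m) := by rw [pow_mul, pow_mul, sq_abs]
  have ha' : 0 ≤ a ^ (2 * m) := by positivity
  have hb' : 0 ≤ b ^ (2 * m) := by positivity
  rw [h0]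
  rcases le_total a b with h | h
  · have : |a - b| ≤ b := by rw [abs_of_nonpos (by linarith)]; linarith
    linarith [pow_le_pow_left₀ (abs_nonneg _) this (2 * m)]
  · have : |a - b| ≤ a := by rw [abs_of_nonneg (by linarith)]; linarith
    linarith [pow_le_pow_left₀ (abs_nonneg _) this (2 * m)]

lemma exp_linear_pow {n : ℕ} (v x : Fin n → ℝ) (p : ℕ) :
    Real.exp (∑ k, v k * x k) ^ p = Real.exp (∑ k, (p * v k) * x k) := by
  rw [← Real.exp_nat_mul, Finset.mul_sum]
  simp only [mul_assoc]

lemma memLp_exp_linear_gaussian {n : ℕ} (v : Fin n → ℝ) (p : ℕ) :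
    MemLp (fun x : Fin n → ℝ => Real.exp (∑ k, v k * x k)) p
      (Measure.pi fun _ : Fin n => gaussianReal 0 1) := by
  refine memLp_of_integrable_even_pow (integrable_exp_linear_gaussian v).1 (fun p => ?_) p
  simp only [exp_linear_pow]
  exact integrable_exp_linear_gaussian fun k => ((2 * p : ℕ) : ℝ) * v k

lemma integral_exp_linear_sub_pow_le {n : ℕ} {v : Fin n → ℝ} {R : ℝ}
    (hv : ∑ k, v k ^ 2 ≤ R) (m : ℕ) :
    ∫ x : Fin n → ℝ, (Real.exp (∑ k, v k * x k) - Real.exp ((∑ k, v k ^ 2) / 2)) ^ (2 * m)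
      ∂(Measure.pi fun _ : Fin n => gaussianReal 0 1) ≤
      Real.exp (2 * m ^ 2 * R) + Real.exp (m * R) := by
  have hi : Integrable (fun x : Fin n → ℝ => Real.exp (∑ k, v k * x k) ^ (2 * m))
      (Measure.pi fun _ : Fin n => gaussianReal 0 1) := by
    simp only [exp_linear_pow]
    exact integrable_exp_linear_gaussian fun k => ((2 * m : ℕ) : ℝ) * v k
  calc _ ≤ ∫ x : Fin n → ℝ, (Real.exp (∑ k, v k * x k) ^ (2 * m) +
          Real.exp ((∑ k, v k ^ 2) / 2) ^ (2 * m))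
          ∂(Measure.pi fun _ : Fin n => gaussianReal 0 1) := by
        refine integral_mono_of_nonneg (Eventually.of_forall fun x => ?_)
          (hi.add (integrable_const _)) (Eventually.of_forall fun x => ?_)
        · simp only [pow_mul, Pi.zero_apply]; positivity
        · exact sub_pow_even_le (Real.exp_pos _).le (Real.exp_pos _).le m
    _ = Real.exp ((∑ k, ((2 * m : ℕ) * v k) ^ 2) / 2) +
          Real.exp ((∑ k, v k ^ 2) / 2) ^ (2 * m) := by
        rw [integral_add hi (integrable_const _)]
        simp only [exp_linear_pow]
        rw [integral_exp_linear_gaussian fun k => ((2 * m : ℕ) : ℝ) * v k]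
        simp
    _ ≤ _ := by
        rw [← Real.exp_nat_mul]
        simp only [mul_pow, ← Finset.mul_sum]
        push_cast
        refine add_le_add (Real.exp_le_exp.2 ?_) (Real.exp_le_exp.2 ?_)
        · nlinarith [mul_le_mul_of_nonneg_left hv (sq_nonneg (m : ℝ))]
        · nlinarith [mul_le_mul_of_nonneg_left hv (Nat.cast_nonneg (α := ℝ) m)]

lemma memLp_sq_sub_one_gaussian (p : ℕ) :
    MemLp (fun x : ℝ => x ^ 2 - 1) p (gaussianReal 0 1) := by
  have hid : ∀ p : ℕ, MemLp (fun x : ℝ => x) p (gaussianReal 0 1) := fun p => by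
    exact_mod_cast memLp_id_gaussianReal (μ := 0) (v := 1) (p : NNReal)
  have h2 : MemLp (fun x : ℝ => x ^ 2) p (gaussianReal 0 1) := by
    refine memLp_of_integrable_even_pow (by fun_prop) (fun q => ?_) p
    simp only [← pow_mul]
    exact integrable_pow_of_memLp hid _
  exact h2.sub (memLp_const 1)

lemma integral_sq_sub_one_gaussian : ∫ x : ℝ, (x ^ 2 - 1) ∂(gaussianReal 0 1) = 0 := by
  have hm : MemLp (id : ℝ → ℝ) 2 (gaussianReal 0 1) := by
    exact_mod_cast memLp_id_gaussianReal (μ := 0) (v := 1) 2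
  have h := variance_eq_sub hm
  rw [variance_id_gaussianReal] at h
  have hi : Integrable (fun x : ℝ => x ^ 2) (gaussianReal 0 1) := hm.integrable_sq
  rw [integral_sub hi (integrable_const _)]
  simp at h
  simp [← h]

lemma abs_exp_sub_exp_le_s12 {a b M : ℝ} (ha : a ≤ M) (hb : b ≤ M) :
    |Real.exp a - Real.exp b| ≤ Real.exp M * |a - b| := by
  have key : ∀ {a b : ℝ}, b ≤ a → a ≤ M → |Real.exp a - Real.exp b| ≤ Real.exp M * |a - b| := by
    intro a b h ha
    rw [abs_of_nonneg (by linarith [Real.exp_le_exp.2 h]), abs_of_nonneg (by linarith)]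
    have h1 : Real.exp b = Real.exp a * Real.exp (b - a) := by rw [← Real.exp_add]; ring_nf
    have h2 := Real.add_one_le_exp (b - a)
    have h3 := Real.exp_pos a
    have h4 := Real.exp_le_exp.2 ha
    nlinarith [mul_le_mul_of_nonneg_right h4 (sub_nonneg.2 h)]
  rcases le_total b a with h | h
  · exact key h ha
  · rw [abs_sub_comm, abs_sub_comm a b]; exact key h hb

/-- The deviation of the empirical exponential mean of a single row from its limit. -/
noncomputable def rowDeviation (β : ℝ) {d : ℕ} (q : Fin d → ℝ) (k : Fin d → Fin d → ℝ) : ℝ :=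
  |(1 / (d : ℝ)) * ∑ j, Real.exp (β * ((Real.sqrt d)⁻¹ * ∑ l, q l * k j l)) -
    Real.exp (β ^ 2 / 2)|

/-- Conditionally on a row whose normalized squared norm is close to one, a large deviation is
unlikely. -/
lemma measureReal_rowDeviation_le (β : ℝ) {γ c : ℝ} (hγ : γ ≤ 1 / 2)
    (hc1 : c ≤ 1) (hc : β ^ 2 * Real.exp (β ^ 2) * c ≤ 1) {m : ℕ}
    (hm : 3 ≤ 2 * m * γ) {d : ℕ} (hd : 0 < d) (q : Fin d → ℝ)
    (hq : |(1 / (d : ℝ)) * ∑ l, (q l ^ 2 - 1)| < c * (d : ℝ) ^ (-(1 / 2 - γ))) :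
    (Measure.pi fun _ : Fin d => Measure.pi fun _ : Fin d => gaussianReal 0 1).real
      {k | (d : ℝ) ^ (-(1 / 2 - γ)) < rowDeviation β q k} ≤
    momentConst (fun m : ℕ => Real.exp (2 * m ^ 2 * (2 * β ^ 2)) + Real.exp (m * (2 * β ^ 2))) m /
      (1 / 2) ^ (2 * m) * ((d : ℝ) ^ 3)⁻¹ := by
  have hd1 : (1 : ℝ) ≤ d := by exact_mod_cast hd
  have hd0 : (0 : ℝ) < d := by linarith
  set t : ℝ := (d : ℝ) ^ (-(1 / 2 - γ)) with ht
  have ht0 : 0 < t := by positivity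
  have ht1 : t ≤ 1 := Real.rpow_le_one_of_one_le_of_nonpos hd1 (by linarith)
  set v : Fin d → ℝ := fun l => β * (Real.sqrt d)⁻¹ * q l with hv
  set u : ℝ := (1 / (d : ℝ)) * ∑ l, q l ^ 2 with hu
  have hvu : ∑ l, v l ^ 2 = β ^ 2 * u := by
    simp only [hv, mul_pow, ← Finset.mul_sum, inv_pow, Real.sq_sqrt hd0.le, hu]
    ring
  have hu1 : (1 / (d : ℝ)) * ∑ l, (q l ^ 2 - 1) = u - 1 := by
    rw [Finset.sum_sub_distrib, mul_sub, hu]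
    simp [hd0.ne']
  rw [hu1] at hq
  have hct : c * t ≤ 1 := by nlinarith
  have hu2 : u ≤ 2 := by linarith [(abs_lt.1 hq).2]
  have hR : ∑ l, v l ^ 2 ≤ 2 * β ^ 2 := by rw [hvu]; nlinarith [sq_nonneg β]
  have hbias : |Real.exp ((∑ l, v l ^ 2) / 2) - Real.exp (β ^ 2 / 2)| ≤ t / 2 := by
    have h := abs_exp_sub_exp_le_s12 (a := (∑ l, v l ^ 2) / 2) (b := β ^ 2 / 2) (M := β ^ 2)
      (by linarith) (by linarith [sq_nonneg β])
    have e : (∑ l, v l ^ 2) / 2 - β ^ 2 / 2 = (β ^ 2 / 2) * (u - 1) := by rw [hvu]; ring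
    rw [e, abs_mul, abs_of_nonneg (by positivity : 0 ≤ β ^ 2 / 2)] at h
    have h2 : Real.exp (β ^ 2) * (β ^ 2 / 2 * |u - 1|) ≤
        Real.exp (β ^ 2) * (β ^ 2 / 2 * (c * t)) := by gcongr
    nlinarith
  refine (measureReal_mono ?_).trans (measureReal_mean_ge_le
    (μ := Measure.pi fun _ : Fin d => gaussianReal 0 1)
    (f := fun x => Real.exp (∑ l, v l * x l) - Real.exp ((∑ l, v l ^ 2) / 2))
    (fun m => by positivity) (by fun_prop)
    (fun p => (memLp_exp_linear_gaussian v p).sub (memLp_const _))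
    (by
      rw [integral_sub (integrable_exp_linear_gaussian v) (integrable_const _),
        integral_exp_linear_gaussian]
      simp)
    (integral_exp_linear_sub_pow_le hR) (by norm_num : (0 : ℝ) < 1 / 2) hm hd)
  intro k hk
  simp only [Set.mem_ofPred_eq, rowDeviation] at hk ⊢
  have e : ∀ j, β * ((Real.sqrt d)⁻¹ * ∑ l, q l * k j l) = ∑ l, v l * k j l := by
    intro j
    rw [← mul_assoc, Finset.mul_sum]
    refine Finset.sum_congr rfl fun l _ => ?_
    simp only [hv]; ring
  simp only [e] at hk
  have e2 : (1 / (d : ℝ)) * ∑ j, (Real.exp (∑ l, v l * k j l) - Real.exp ((∑ l, v l ^ 2) / 2)) =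
      (1 / (d : ℝ)) * ∑ j, Real.exp (∑ l, v l * k j l) - Real.exp ((∑ l, v l ^ 2) / 2) := by
    rw [Finset.sum_sub_distrib, mul_sub]
    simp [hd0.ne']
  rw [e2, ← ht]
  have := abs_sub_le ((1 / (d : ℝ)) * ∑ j, Real.exp (∑ l, v l * k j l))
    (Real.exp ((∑ l, v l ^ 2) / 2)) (Real.exp (β ^ 2 / 2))
  linarith

/-- The law of the pair of weight matrices. -/
noncomputable abbrev weightLaw (d : ℕ) :
    Measure ((Fin d → Fin d → ℝ) × (Fin d → Fin d → ℝ)) :=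
  (Measure.pi fun _ : Fin d => Measure.pi fun _ : Fin d => gaussianReal 0 1).prod
    (Measure.pi fun _ : Fin d => Measure.pi fun _ : Fin d => gaussianReal 0 1)

lemma measurableSet_rowDeviation (β t : ℝ) {d : ℕ} (i : Fin d) :
    MeasurableSet {w : (Fin d → Fin d → ℝ) × (Fin d → Fin d → ℝ) |
      t < rowDeviation β (w.1 i) w.2} := by
  refine measurableSet_lt measurable_const ?_
  unfold rowDeviation
  fun_prop

lemma exists_weightLaw_rowDeviation_le (β : ℝ) {γ : ℝ} (hγ0 : 0 < γ) (hγ : γ ≤ 1 / 2) :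
    ∃ K : ℝ, 0 ≤ K ∧ ∀ d : ℕ, 0 < d → ∀ i : Fin d,
      weightLaw d {w | (d : ℝ) ^ (-(1 / 2 - γ)) < rowDeviation β (w.1 i) w.2} ≤
        ENNReal.ofReal (K * ((d : ℝ) ^ 3)⁻¹) := by
  obtain ⟨m, hm⟩ := exists_nat_ge (3 / (2 * γ))
  have hm' : 3 ≤ 2 * m * γ := by
    rw [div_le_iff₀ (by positivity)] at hm; linarith
  set L : ℝ := β ^ 2 * Real.exp (β ^ 2) with hL
  have hL0 : 0 ≤ L := by positivity
  set c : ℝ := 1 / (L + 1) with hc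
  have hc0 : 0 < c := by positivity
  have hc1 : c ≤ 1 := by rw [hc, div_le_one (by positivity)]; linarith
  have hcL : L * c ≤ 1 := by
    rw [hc, mul_one_div, div_le_one (by positivity)]; linarith
  set B₁ : ℕ → ℝ := fun m => ∫ x : ℝ, (x ^ 2 - 1) ^ (2 * m) ∂(gaussianReal 0 1) with hB₁
  have hB₁0 : ∀ m, 0 ≤ B₁ m := fun m =>
    integral_nonneg fun ω => by simp only [pow_mul, Pi.zero_apply]; positivity
  set K₁ : ℝ := momentConst B₁ m / c ^ (2 * m)
  have hK₁ : 0 ≤ K₁ := div_nonneg (momentConst_nonneg hB₁0 m) (by positivity)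
  set K₂ : ℝ := momentConst (fun m : ℕ => Real.exp (2 * m ^ 2 * (2 * β ^ 2)) +
    Real.exp (m * (2 * β ^ 2))) m / (1 / 2) ^ (2 * m)
  have hK₂ : 0 ≤ K₂ :=
    div_nonneg (momentConst_nonneg (fun m => by positivity) m) (by positivity)
  refine ⟨K₁ + K₂, by positivity, fun d hd i => ?_⟩
  set t : ℝ := (d : ℝ) ^ (-(1 / 2 - γ)) with ht
  set A : Set (Fin d → ℝ) := {q | c * t ≤ |(1 / (d : ℝ)) * ∑ l, (q l ^ 2 - 1)|} with hA
  have hAm : MeasurableSet A := measurableSet_le measurable_const (by fun_prop)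
  have hAi : MeasurableSet (Function.eval i ⁻¹' A : Set (Fin d → Fin d → ℝ)) :=
    hAm.preimage (measurable_pi_apply i)
  rw [weightLaw, Measure.prod_apply (measurableSet_rowDeviation β t i)]
  have hPA : (Measure.pi fun _ : Fin d => Measure.pi fun _ : Fin d => gaussianReal 0 1)
      (Function.eval i ⁻¹' A) ≤ ENNReal.ofReal (K₁ * ((d : ℝ) ^ 3)⁻¹) := by
    rw [(measurePreserving_eval (fun _ : Fin d => Measure.pi fun _ : Fin d => gaussianReal 0 1)
      i).measure_preimage hAm.nullMeasurableSet, ← ofReal_measureReal]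
    exact ENNReal.ofReal_le_ofReal (measureReal_mean_ge_le (f := fun x : ℝ => x ^ 2 - 1) hB₁0
      (by fun_prop) memLp_sq_sub_one_gaussian integral_sq_sub_one_gaussian (fun m => le_rfl)
      hc0 hm' hd)
  calc _ ≤ ∫⁻ q, ((Function.eval i ⁻¹' A).indicator 1 q + ENNReal.ofReal (K₂ * ((d : ℝ) ^ 3)⁻¹))
        ∂(Measure.pi fun _ : Fin d => Measure.pi fun _ : Fin d => gaussianReal 0 1) := by
        refine lintegral_mono fun q => ?_
        by_cases hq : q ∈ (Function.eval i ⁻¹' A : Set (Fin d → Fin d → ℝ))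
        · rw [Set.indicator_of_mem hq]
          exact prob_le_one.trans le_self_add
        · rw [Set.indicator_of_notMem hq, zero_add, ← ofReal_measureReal]
          refine ENNReal.ofReal_le_ofReal ?_
          exact measureReal_rowDeviation_le β hγ hc1 hcL hm' hd (q i) (not_le.1 hq)
    _ ≤ ENNReal.ofReal (K₁ * ((d : ℝ) ^ 3)⁻¹) + ENNReal.ofReal (K₂ * ((d : ℝ) ^ 3)⁻¹) := by
        rw [lintegral_add_right _ measurable_const, lintegral_indicator_one hAi]
        simpa using hPA
    _ = _ := by
        rw [← ENNReal.ofReal_add (by positivity) (by positivity), add_mul]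

/-- Fix `β > 0` and `δ ∈ (0,1/2]`. Almost surely,
`max_{1≤i≤d} d^{1/2−δ} |(1/d) Σ_j exp(β (S_d)_{ij}) − e^{β²/2}| → 0` as `d → ∞`. -/
theorem stmt12 {Ω : Type*} [MeasurableSpace Ω] (P : Measure Ω) [IsProbabilityMeasure P]
    (β δ : ℝ) (hβ : 0 < β) (hδ : 0 < δ) (hδ' : δ ≤ 1 / 2)
    (WQ WK : (d : ℕ) → Ω → Fin d → Fin d → ℝ)
    (hlaw : ∀ d : ℕ, Measure.map (fun ω => (WQ d ω, WK d ω)) P =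
      (Measure.pi fun _ : Fin d => Measure.pi fun _ : Fin d => gaussianReal 0 1).prod
        (Measure.pi fun _ : Fin d => Measure.pi fun _ : Fin d => gaussianReal 0 1)) :
    ∀ᵐ ω ∂P,
      Tendsto (fun d : ℕ => ⨆ i : Fin d, (d : ℝ) ^ ((1 : ℝ) / 2 - δ) *
          |(1 / (d : ℝ)) * ∑ j, Real.exp (β * scoreS WQ WK d ω i j) -
            Real.exp (β ^ 2 / 2)|)
        atTop (nhds 0) := by
  have hγ0 : 0 < δ / 2 := by positivity
  obtain ⟨K, hK0, hK⟩ := exists_weightLaw_rowDeviation_le β hγ0 (by linarith)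
  have hae : ∀ d, AEMeasurable (fun ω => (WQ d ω, WK d ω)) P := by
    intro d
    by_contra h
    have h1 := hlaw d
    rw [Measure.map_of_not_aemeasurable h] at h1
    exact IsProbabilityMeasure.ne_zero (weightLaw d) h1.symm
  have hdev : ∀ (d : ℕ) (ω : Ω) (i : Fin d),
      |(1 / (d : ℝ)) * ∑ j, Real.exp (β * scoreS WQ WK d ω i j) - Real.exp (β ^ 2 / 2)| =
        rowDeviation β (WQ d ω i) (WK d ω) := by
    intro d ω i
    simp [rowDeviation, scoreS, Matrix.mul_apply]
  have hbad : ∀ d : ℕ, P {ω | ∃ i : Fin d, (d : ℝ) ^ (-(1 / 2 - δ / 2)) <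
      rowDeviation β (WQ d ω i) (WK d ω)} ≤ ENNReal.ofReal (K * (1 / (d : ℝ) ^ 2)) := by
    intro d
    rcases Nat.eq_zero_or_pos d with rfl | hd
    · simp
    have hd0 : (0 : ℝ) < d := by exact_mod_cast hd
    have hi : ∀ i : Fin d, P {ω | (d : ℝ) ^ (-(1 / 2 - δ / 2)) <
        rowDeviation β (WQ d ω i) (WK d ω)} ≤ ENNReal.ofReal (K * ((d : ℝ) ^ 3)⁻¹) := by
      intro i
      have h := hK d hd i
      rw [weightLaw, ← hlaw d,
        Measure.map_apply_of_aemeasurable (hae d) (measurableSet_rowDeviation β _ i)] at h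
      exact h
    calc _ = P (⋃ i : Fin d, {ω | (d : ℝ) ^ (-(1 / 2 - δ / 2)) <
            rowDeviation β (WQ d ω i) (WK d ω)}) := by
          congr 1; ext ω; simp
      _ ≤ ∑ i : Fin d, P {ω | (d : ℝ) ^ (-(1 / 2 - δ / 2)) <
            rowDeviation β (WQ d ω i) (WK d ω)} := measure_iUnion_fintype_le _ _
      _ ≤ ∑ _i : Fin d, ENNReal.ofReal (K * ((d : ℝ) ^ 3)⁻¹) := Finset.sum_le_sum fun i _ => hi i
      _ = ENNReal.ofReal (d * (K * ((d : ℝ) ^ 3)⁻¹)) := by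
          rw [ENNReal.ofReal_mul hd0.le]; simp
      _ = _ := by
          congr 1
          field_simp
  have hsum : ∑' d : ℕ, P {ω | ∃ i : Fin d, (d : ℝ) ^ (-(1 / 2 - δ / 2)) <
      rowDeviation β (WQ d ω i) (WK d ω)} ≠ ⊤ :=
    ne_top_of_le_ne_top
      ((Real.summable_one_div_nat_pow.2 one_lt_two).mul_left K).tsum_ofReal_ne_top
      (ENNReal.tsum_le_tsum hbad)
  filter_upwards [ae_eventually_notMem hsum] with ω hω
  simp only [hdev]
  have hlim : Tendsto (fun d : ℕ => (d : ℝ) ^ (-(δ / 2))) atTop (nhds 0) :=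
    (tendsto_rpow_neg_atTop hγ0).comp tendsto_natCast_atTop_atTop
  refine squeeze_zero' (Eventually.of_forall fun d => Real.iSup_nonneg fun i =>
    mul_nonneg (by positivity) (abs_nonneg _)) ?_ hlim
  filter_upwards [hω, eventually_gt_atTop 0] with d hd hd0
  have hd0' : (0 : ℝ) < d := by exact_mod_cast hd0
  simp only [not_exists, not_lt] at hd
  refine Real.iSup_le (fun i => ?_) (by positivity)
  calc _ ≤ (d : ℝ) ^ ((1 : ℝ) / 2 - δ) * (d : ℝ) ^ (-(1 / 2 - δ / 2)) := by
        gcongr; exact hd i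
    _ = _ := by
        rw [← Real.rpow_add hd0']
        congr 1; ring
end
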